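/- Let F and G be proper filters in S with d(F) = r(G), and let s ∈ F and t ∈ G. Then F·G is a proper filter, s·t ∈ F·G, d(F·G) ∩ E = d(G) ∩ E, and d(F) ∩ E = β_t(d(G) ∩ E). (Hence the filters-to-germs map π sends the product F·G to the product of germs [s, d(F) ∩ E]·[t, d(G) ∩ E] = [s·t, d(G) ∩ E].) -/

import Mathlib

/-- An inverse semigroup with zero: every element `a` has a unique `a⁻¹` with
`a * a⁻¹ * a = a` and `a⁻¹ * a * a⁻¹ = a⁻¹`, and `0` is absorbing. -/
class InvSemigroupWithZero (S : Type*) extends Semigroup S, Zero S, Inv S where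
  mul_inv_mul : ∀ a : S, a * a⁻¹ * a = a
  inv_mul_inv : ∀ a : S, a⁻¹ * a * a⁻¹ = a⁻¹
  inv_unique : ∀ a b : S, a * b * a = a → b * a * b = b → b = a⁻¹
  zero_mul : ∀ a : S, 0 * a = 0
  mul_zero : ∀ a : S, a * 0 = 0

namespace InvSemigroupWithZero

variable {S : Type*} [InvSemigroupWithZero S]

/-- The natural partial order on `S`: `a ≤ b` iff `a = a * a⁻¹ * b`. -/
def sle (a b : S) : Prop := a = a * a⁻¹ * b

/-- `↓s`, the down-set of `s` w.r.t. the natural partial order. -/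
def dwn (s : S) : Set S := {t : S | sle t s}

/-- `↑A`, the up-set generated by `A` w.r.t. the natural partial order. -/
def up (A : Set S) : Set S := {b : S | ∃ a ∈ A, sle a b}

/-- A filter in `S`: a nonempty down-directed up-set. -/
def IsFilt (F : Set S) : Prop :=
  F.Nonempty ∧ up F = F ∧ ∀ a ∈ F, ∀ b ∈ F, ∃ c ∈ F, sle c a ∧ sle c b

/-- A proper filter: a filter not containing `0`. -/
def IsPFilt (F : Set S) : Prop := IsFilt F ∧ (0 : S) ∉ F

/-- An ultrafilter: a proper filter maximal among proper filters. -/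
def IsUltra (U : Set S) : Prop :=
  IsPFilt U ∧ ∀ G : Set S, IsPFilt G → U ⊆ G → U = G

/-- The set `E` of idempotents of `S`. -/
def E (S : Type*) [InvSemigroupWithZero S] : Set S := {e : S | e * e = e}

/-- `F⁻¹ = {a⁻¹ : a ∈ F}`. -/
def finv (F : Set S) : Set S := (fun a : S => a⁻¹) '' F

/-- `F · G = ↑{fg : f ∈ F, g ∈ G}`. -/
def fmul (F G : Set S) : Set S := up (Set.image2 (· * ·) F G)

/-- The source `d(F) := F⁻¹ · F`. -/
def src (F : Set S) : Set S := fmul (finv F) F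

/-- The range `r(F) := F · F⁻¹`. -/
def rng (F : Set S) : Set S := fmul F (finv F)

/-- The natural partial order on the idempotents: `e ≤ f` iff `e = e * f`. -/
def ele (e f : S) : Prop := e = e * f

/-- The down-set of an idempotent `e` inside `E`. -/
def edwn (e : S) : Set S := {f : S | f ∈ E S ∧ ele f e}

/-- The up-set generated by `A` inside `E`. -/
def eup (A : Set S) : Set S := {f : S | f ∈ E S ∧ ∃ a ∈ A, ele a f}

/-- An `E`-filter: a proper filter of the inverse semigroup `E` of idempotents. -/
def IsEFilt (ξ : Set S) : Prop :=
  ξ ⊆ E S ∧ ξ.Nonempty ∧ eup ξ = ξ ∧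
    (∀ a ∈ ξ, ∀ b ∈ ξ, ∃ c ∈ ξ, ele c a ∧ ele c b) ∧ (0 : S) ∉ ξ

/-- An `E`-ultrafilter: an `E`-filter maximal among `E`-filters. -/
def IsEUltra (ξ : Set S) : Prop :=
  IsEFilt ξ ∧ ∀ η : Set S, IsEFilt η → ξ ⊆ η → ξ = η

/-- `β_s(ξ) = {f ∈ E : s·e·s⁻¹ ≤ f for some e ∈ ξ}`. -/
def beta (s : S) (ξ : Set S) : Set S :=
  {f : S | f ∈ E S ∧ ∃ e ∈ ξ, sle (s * e * s⁻¹) f}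

/-- The set of proper filters in `S`. -/
abbrev PFilt (S : Type*) [InvSemigroupWithZero S] := {F : Set S // IsPFilt F}

/-- The patch topology on the set of proper filters, generated by the sets
`F(s;T) = {F : s ∈ F, F ∩ T = ∅}` for `s ∈ S` and finite `T ⊆ ↓s`. -/
instance patchTopology : TopologicalSpace (PFilt S) :=
  TopologicalSpace.generateFrom
    {O : Set (PFilt S) | ∃ (s : S) (T : Set S), T.Finite ∧ T ⊆ dwn s ∧
      O = {F : PFilt S | s ∈ F.1 ∧ F.1 ∩ T = ∅}}

/-- The set of idempotent proper filters in `S`. -/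
abbrev IPFilt (S : Type*) [InvSemigroupWithZero S] :=
  {F : Set S // IsPFilt F ∧ (F ∩ E S).Nonempty}

/-- The subspace topology induced by the patch topology on proper filters. -/
instance : TopologicalSpace (IPFilt S) :=
  TopologicalSpace.induced (fun F => (⟨F.1, F.2.1⟩ : PFilt S)) inferInstance

/-- The set of `E`-filters. -/
abbrev EFilt (S : Type*) [InvSemigroupWithZero S] := {ξ : Set S // IsEFilt ξ}

/-- The patch topology on the set of `E`-filters, generated by the sets
`P(e;X) = {ξ : e ∈ ξ, ξ ∩ X = ∅}` for `e ∈ E` and finite `X ⊆ ↓e ∩ E`. -/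
instance : TopologicalSpace (EFilt S) :=
  TopologicalSpace.generateFrom
    {O : Set (EFilt S) | ∃ (e : S) (X : Set S), e ∈ E S ∧ X.Finite ∧ X ⊆ edwn e ∧
      O = {ξ : EFilt S | e ∈ ξ.1 ∧ ξ.1 ∩ X = ∅}}

/-- The set of ultrafilters in `S`. -/
abbrev UFilt (S : Type*) [InvSemigroupWithZero S] := {U : Set S // IsUltra U}

/-- The subspace topology induced by the patch topology on proper filters. -/
instance : TopologicalSpace (UFilt S) :=
  TopologicalSpace.induced (fun U => (⟨U.1, U.2.1⟩ : PFilt S)) inferInstance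

end InvSemigroupWithZero

open InvSemigroupWithZero

namespace InvSemigroupWithZero

section Basic

variable {S : Type*} [InvSemigroupWithZero S]

theorem inv_inv' (a : S) : a⁻¹⁻¹ = a :=
  (inv_unique a⁻¹ a (inv_mul_inv a) (mul_inv_mul a)).symm

theorem inv_of_mem_E {e : S} (he : e ∈ E S) : e⁻¹ = e := by
  have h : e * e = e := he
  exact (inv_unique e e (by rw [h, h]) (by rw [h, h])).symm

theorem mul_mem_E {e f : S} (he : e ∈ E S) (hf : f ∈ E S) : e * f ∈ E S := by
  have he' : e * e = e := he
  have hf' : f * f = f := hf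
  have h1 := mul_inv_mul (e * f)
  have h2 := inv_mul_inv (e * f)
  set x := (e * f)⁻¹ with hx
  have hfe : f * x * e = x := by
    apply inv_unique
    · calc e * f * (f * x * e) * (e * f) = e * (f * f) * x * ((e * e) * f) := by
            simp only [mul_assoc]
        _ = e * f := by rw [he', hf', h1]
    · calc f * x * e * (e * f) * (f * x * e) = f * (x * ((e * e) * (f * f)) * x) * e := by
            simp only [mul_assoc]
        _ = f * x * e := by rw [he', hf', h2]
  have hxx : x ∈ E S := by
    change x * x = x
    calc x * x = (f * x * e) * (f * x * e) := by rw [hfe]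
      _ = f * (x * (e * f) * x) * e := by simp only [mul_assoc]
      _ = x := by rw [h2, hfe]
  have hef : e * f = x := by
    rw [← inv_inv' (e * f), ← hx, inv_of_mem_E hxx]
  rw [hef]
  exact hxx

theorem E_comm {e f : S} (he : e ∈ E S) (hf : f ∈ E S) : e * f = f * e := by
  have he' : e * e = e := he
  have hf' : f * f = f := hf
  have h1 : e * f * (e * f) = e * f := mul_mem_E he hf
  have h2 : f * e * (f * e) = f * e := mul_mem_E hf he
  have h : f * e = (e * f)⁻¹ := by
    apply inv_unique
    · calc e * f * (f * e) * (e * f) = e * (f * f) * ((e * e) * f) := by simp only [mul_assoc]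
        _ = e * f := by rw [he', hf', h1]
    · calc f * e * (e * f) * (f * e) = f * (e * e) * ((f * f) * e) := by simp only [mul_assoc]
        _ = f * e := by rw [he', hf', h2]
  rw [h, inv_of_mem_E (mul_mem_E he hf)]

theorem mul_inv_mem_E (a : S) : a * a⁻¹ ∈ E S := by
  change a * a⁻¹ * (a * a⁻¹) = a * a⁻¹
  rw [← mul_assoc, mul_inv_mul]

theorem inv_mul_mem_E (a : S) : a⁻¹ * a ∈ E S := by
  change a⁻¹ * a * (a⁻¹ * a) = a⁻¹ * a
  rw [← mul_assoc, inv_mul_inv]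

theorem mul_inv_rev' (a b : S) : (a * b)⁻¹ = b⁻¹ * a⁻¹ := by
  have h := E_comm (mul_inv_mem_E b) (inv_mul_mem_E a)
  symm
  apply inv_unique
  · calc a * b * (b⁻¹ * a⁻¹) * (a * b) = a * ((b * b⁻¹) * (a⁻¹ * a)) * b := by
          simp only [mul_assoc]
      _ = (a * a⁻¹ * a) * (b * b⁻¹ * b) := by rw [h]; simp only [mul_assoc]
      _ = a * b := by rw [mul_inv_mul, mul_inv_mul]
  · calc b⁻¹ * a⁻¹ * (a * b) * (b⁻¹ * a⁻¹) = b⁻¹ * ((a⁻¹ * a) * (b * b⁻¹)) * a⁻¹ := by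
          simp only [mul_assoc]
      _ = (b⁻¹ * b * b⁻¹) * (a⁻¹ * a * a⁻¹) := by rw [← h]; simp only [mul_assoc]
      _ = b⁻¹ * a⁻¹ := by rw [inv_mul_inv, inv_mul_inv]

theorem conj_mem_E (b : S) {f : S} (hf : f ∈ E S) : b * f * b⁻¹ ∈ E S := by
  have hf' : f * f = f := hf
  change b * f * b⁻¹ * (b * f * b⁻¹) = b * f * b⁻¹
  calc b * f * b⁻¹ * (b * f * b⁻¹) = b * (f * (b⁻¹ * b)) * f * b⁻¹ := by simp only [mul_assoc]
    _ = (b * b⁻¹ * b) * (f * f) * b⁻¹ := by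
        rw [E_comm hf (inv_mul_mem_E b)]; simp only [mul_assoc]
    _ = b * f * b⁻¹ := by rw [hf', mul_inv_mul]

theorem mul_E_eq (b : S) {f : S} (hf : f ∈ E S) : b * f = b * f * b⁻¹ * b := by
  calc b * f = b * ((b⁻¹ * b) * f) := by
        simp only [← mul_assoc]; rw [mul_inv_mul]
    _ = b * f * b⁻¹ * b := by
        rw [E_comm (inv_mul_mem_E b) hf]; simp only [mul_assoc]

theorem sle_of_E_mul {e : S} (b : S) (he : e ∈ E S) : sle (e * b) b := by
  have he' : e * e = e := he
  change e * b = e * b * (e * b)⁻¹ * b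
  rw [mul_inv_rev', inv_of_mem_E he]
  symm
  calc e * b * (b⁻¹ * e) * b = e * ((b * b⁻¹) * e) * b := by simp only [mul_assoc]
    _ = (e * e) * (b * b⁻¹ * b) := by
        rw [E_comm (mul_inv_mem_E b) he]; simp only [mul_assoc]
    _ = e * b := by rw [he', mul_inv_mul]

theorem sle_iff {a b : S} : sle a b ↔ ∃ e ∈ E S, a = e * b :=
  ⟨fun h => ⟨_, mul_inv_mem_E a, h⟩, by rintro ⟨e, he, rfl⟩; exact sle_of_E_mul b he⟩

theorem sle_refl (a : S) : sle a a := (mul_inv_mul a).symm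

theorem sle_trans {a b c : S} (hab : sle a b) (hbc : sle b c) : sle a c := by
  obtain ⟨e, he, rfl⟩ := sle_iff.1 hab
  obtain ⟨f, hf, rfl⟩ := sle_iff.1 hbc
  rw [← mul_assoc]
  exact sle_of_E_mul c (mul_mem_E he hf)

theorem sle_mul {a b c d : S} (hab : sle a b) (hcd : sle c d) : sle (a * c) (b * d) := by
  obtain ⟨e, he, rfl⟩ := sle_iff.1 hab
  obtain ⟨f, hf, rfl⟩ := sle_iff.1 hcd
  refine sle_iff.2 ⟨e * (b * f * b⁻¹), mul_mem_E he (conj_mem_E b hf), ?_⟩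
  calc e * b * (f * d) = e * (b * f) * d := by simp only [mul_assoc]
    _ = e * (b * f * b⁻¹) * (b * d) := by
        rw [mul_E_eq b hf]; simp only [mul_assoc]
        simp only [← mul_assoc, mul_inv_mul]

theorem sle_inv {a b : S} (hab : sle a b) : sle a⁻¹ b⁻¹ := by
  obtain ⟨e, he, rfl⟩ := sle_iff.1 hab
  rw [mul_inv_rev', inv_of_mem_E he, mul_E_eq b⁻¹ he]
  exact sle_of_E_mul _ (conj_mem_E _ he)

theorem eq_zero_of_sle_zero {a : S} (h : sle a 0) : a = 0 := by
  have h' : a = a * a⁻¹ * 0 := h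
  rw [h', InvSemigroupWithZero.mul_zero]

theorem mul_inv_eq_of_sle {a b : S} (h : sle a b) : a * b⁻¹ = a * a⁻¹ := by
  obtain ⟨e, he, rfl⟩ := sle_iff.1 h
  have he' : e * e = e := he
  rw [mul_inv_rev', inv_of_mem_E he]
  symm
  calc e * b * (b⁻¹ * e) = e * ((b * b⁻¹) * e) := by simp only [mul_assoc]
    _ = (e * e) * (b * b⁻¹) := by rw [E_comm (mul_inv_mem_E b) he]; simp only [mul_assoc]
    _ = e * b * b⁻¹ := by rw [he']; simp only [mul_assoc]

theorem conj_inv_mul_of_sle {a b : S} (h : sle a b) : b * (a⁻¹ * a) * b⁻¹ = a * a⁻¹ := by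
  have h1 := mul_inv_eq_of_sle h
  have h2 : b * a⁻¹ = a * a⁻¹ := by
    have := congrArg (fun x => x⁻¹) h1
    simpa only [mul_inv_rev', inv_inv'] using this
  calc b * (a⁻¹ * a) * b⁻¹ = (b * a⁻¹) * (a * b⁻¹) := by simp only [mul_assoc]
    _ = a * a⁻¹ := by rw [h1, h2]; exact mul_inv_mem_E a

end Basic

section Filters

variable {S : Type*} [InvSemigroupWithZero S] {F G : Set S}

theorem IsFilt.mem_of_sle (hF : IsFilt F) {a b : S} (ha : a ∈ F) (h : sle a b) : b ∈ F := by
  rw [← hF.2.1]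
  exact ⟨a, ha, h⟩

theorem mem_fmul {x : S} : x ∈ fmul F G ↔ ∃ f ∈ F, ∃ g ∈ G, sle (f * g) x := by
  constructor
  · rintro ⟨_, ⟨f, hf, g, hg, rfl⟩, h⟩
    exact ⟨f, hf, g, hg, h⟩
  · rintro ⟨f, hf, g, hg, h⟩
    exact ⟨_, ⟨f, hf, g, hg, rfl⟩, h⟩

theorem IsFilt.mem_src (hF : IsFilt F) {x : S} : x ∈ src F ↔ ∃ h ∈ F, sle (h⁻¹ * h) x := by
  constructor
  · intro hx
    obtain ⟨_, ⟨a, ha, rfl⟩, b, hb, hab⟩ := mem_fmul.1 hx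
    obtain ⟨c, hc, hca, hcb⟩ := hF.2.2 a ha b hb
    exact ⟨c, hc, sle_trans (sle_mul (sle_inv hca) hcb) hab⟩
  · rintro ⟨h, hh, hx⟩
    exact mem_fmul.2 ⟨h⁻¹, ⟨h, hh, rfl⟩, h, hh, hx⟩

theorem IsFilt.mem_rng (hF : IsFilt F) {x : S} : x ∈ rng F ↔ ∃ h ∈ F, sle (h * h⁻¹) x := by
  constructor
  · intro hx
    obtain ⟨a, ha, _, ⟨b, hb, rfl⟩, hab⟩ := mem_fmul.1 hx
    obtain ⟨c, hc, hca, hcb⟩ := hF.2.2 a ha b hb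
    exact ⟨c, hc, sle_trans (sle_mul hca (sle_inv hcb)) hab⟩
  · rintro ⟨h, hh, hx⟩
    exact mem_fmul.2 ⟨h, hh, h⁻¹, ⟨h, hh, rfl⟩, hx⟩

theorem mul_mem_fmul {f g : S} (hf : f ∈ F) (hg : g ∈ G) : f * g ∈ fmul F G :=
  mem_fmul.2 ⟨f, hf, g, hg, sle_refl _⟩

theorem IsFilt.fmul (hF : IsFilt F) (hG : IsFilt G) : IsFilt (fmul F G) := by
  refine ⟨?_, ?_, ?_⟩
  · obtain ⟨f, hf⟩ := hF.1
    obtain ⟨g, hg⟩ := hG.1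
    exact ⟨_, mul_mem_fmul hf hg⟩
  · ext x
    constructor
    · rintro ⟨y, hy, hyx⟩
      obtain ⟨f, hf, g, hg, h⟩ := mem_fmul.1 hy
      exact mem_fmul.2 ⟨f, hf, g, hg, sle_trans h hyx⟩
    · exact fun hx => ⟨x, hx, sle_refl x⟩
  · intro a ha b hb
    obtain ⟨f, hf, g, hg, h⟩ := mem_fmul.1 ha
    obtain ⟨f', hf', g', hg', h'⟩ := mem_fmul.1 hb
    obtain ⟨p, hp, hpf, hpf'⟩ := hF.2.2 f hf f' hf'
    obtain ⟨q, hq, hqg, hqg'⟩ := hG.2.2 g hg g' hg'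
    exact ⟨p * q, mul_mem_fmul hp hq, sle_trans (sle_mul hpf hqg) h,
      sle_trans (sle_mul hpf' hqg') h'⟩

theorem IsPFilt.fmul (hF : IsPFilt F) (hG : IsPFilt G) (hdr : src F = rng G) :
    IsPFilt (fmul F G) := by
  refine ⟨hF.1.fmul hG.1, fun h0 => ?_⟩
  obtain ⟨f, hf, g, hg, h⟩ := mem_fmul.1 h0
  have hgg : g * g⁻¹ ∈ src F := hdr ▸ hG.1.mem_rng.2 ⟨g, hg, sle_refl _⟩
  obtain ⟨p, hp, hpg⟩ := hF.1.mem_src.1 hgg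
  obtain ⟨q, hq, hqf, hqp⟩ := hF.1.2.2 f hf p hp
  have key : sle (q * (q⁻¹ * q)) (f * (g * g⁻¹)) :=
    sle_mul hqf (sle_trans (sle_mul (sle_inv hqp) hqp) hpg)
  rw [← mul_assoc, mul_inv_mul, ← mul_assoc, eq_zero_of_sle_zero h,
    InvSemigroupWithZero.zero_mul] at key
  exact hF.2 (hF.1.mem_of_sle hq key)

theorem src_fmul (hF : IsFilt F) (hG : IsFilt G) (hdr : src F = rng G) :
    src (fmul F G) = src G := by
  ext x
  rw [(hF.fmul hG).mem_src, hG.mem_src]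
  constructor
  · rintro ⟨y, hy, hyx⟩
    obtain ⟨f, hf, g, hg, h⟩ := mem_fmul.1 hy
    have hff : f⁻¹ * f ∈ rng G := hdr ▸ hF.mem_src.2 ⟨f, hf, sle_refl _⟩
    obtain ⟨p, hp, hpf⟩ := hG.mem_rng.1 hff
    obtain ⟨q, hq, hqg, hqp⟩ := hG.2.2 g hg p hp
    refine ⟨q, hq, sle_trans (sle_trans ?_ (sle_mul (sle_inv h) h)) hyx⟩
    have key : sle (q⁻¹ * (q * q⁻¹) * q) (g⁻¹ * (f⁻¹ * f) * g) :=
      sle_mul (sle_mul (sle_inv hqg) (sle_trans (sle_mul hqp (sle_inv hqp)) hpf)) hqg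
    rw [← mul_assoc, inv_mul_inv] at key
    simpa only [mul_inv_rev', mul_assoc] using key
  · rintro ⟨h, hh, hx⟩
    obtain ⟨f, hf⟩ := hF.1
    refine ⟨f * h, mul_mem_fmul hf hh, sle_trans ?_ hx⟩
    have key : sle (h⁻¹ * (f⁻¹ * f * h)) (h⁻¹ * h) :=
      sle_mul (sle_refl _) (sle_of_E_mul h (inv_mul_mem_E f))
    simpa only [mul_inv_rev', mul_assoc] using key

theorem rng_inter_E_eq_beta (hG : IsFilt G) {t : S} (ht : t ∈ G) :
    rng G ∩ E S = beta t (src G ∩ E S) := by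
  ext x
  constructor
  · rintro ⟨hx, hxE⟩
    obtain ⟨g, hg, hgx⟩ := hG.mem_rng.1 hx
    obtain ⟨h, hh, hhg, hht⟩ := hG.2.2 g hg t ht
    refine ⟨hxE, h⁻¹ * h, ⟨hG.mem_src.2 ⟨h, hh, sle_refl _⟩, inv_mul_mem_E h⟩, ?_⟩
    rw [conj_inv_mul_of_sle hht]
    exact sle_trans (sle_mul hhg (sle_inv hhg)) hgx
  · rintro ⟨hxE, e, ⟨he, -⟩, hx⟩
    obtain ⟨g, hg, hge⟩ := hG.mem_src.1 he
    obtain ⟨h, hh, hhg, hht⟩ := hG.2.2 g hg t ht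
    refine ⟨hG.mem_rng.2 ⟨h, hh, sle_trans ?_ hx⟩, hxE⟩
    rw [← conj_inv_mul_of_sle hht]
    exact sle_mul (sle_mul (sle_refl t) (sle_trans (sle_mul (sle_inv hhg) hhg) hge)) (sle_refl _)

end Filters

end InvSemigroupWithZero

/-- If `F, G` are proper filters with `d(F) = r(G)`, `s ∈ F` and `t ∈ G`,
then `F·G` is a proper filter, `s·t ∈ F·G`, `d(F·G) ∩ E = d(G) ∩ E`, and
`d(F) ∩ E = β_t(d(G) ∩ E)`. -/
theorem stmt_16 {S : Type*} [InvSemigroupWithZero S]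
    (F G : Set S) (hF : IsPFilt F) (hG : IsPFilt G)
    (hdr : src F = rng G) (s t : S) (hs : s ∈ F) (ht : t ∈ G) :
    IsPFilt (fmul F G) ∧ s * t ∈ fmul F G ∧
    src (fmul F G) ∩ E S = src G ∩ E S ∧
    src F ∩ E S = beta t (src G ∩ E S) := by
  exact ⟨hF.fmul hG hdr, mul_mem_fmul hs ht, by rw [src_fmul hF.1 hG.1 hdr],
    by rw [hdr, rng_inter_E_eq_beta hG.1 ht]⟩
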